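/- Let c₀ ∈ (0, 1/3) be a constant and ε ∈ (0, 1/2) fixed. There exists δ₀ > 0 (depending only on ε and c₀) such that for every δ ∈ (0, δ₀) the following holds: if G is a Label-Cover instance (bi-regular, satisfying c₀-smoothness) such that every labeling of G satisfies at most an s fraction of edges, where s < δ^{10/c₀ + 5}/4, then the constraint hypergraph of the 4-LIN-CSP instance 𝒢 produced by the long code test 𝒯₃ has no independent set of fractional size δ; that is, there is no subset I ⊆ V × {0,1}^{2R} with |I| ≥ δ·|V|·2^{2R} such that no constraint 4-tuple occurring with positive probability under 𝒯₃ has all four of its queried variables in I. -/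

import Mathlib

open Finset

/-! Common setup for the long code test `𝒯₃` (the `4`-LIN test).  Strings in `{0,1}^{2R}`
are indexed by `Fin R ⊕ Fin R` and strings in `{0,1}^{2L}` by `Fin L ⊕ Fin L`, the left
summand being the first half and the right summand the second half. -/

/-- `y ∘ π`: `(y ∘ π)_i = y_{π(i)}` for `i ∈ [R]` and `(y ∘ π)_i = y_{π(i−R)+L}`
otherwise. -/
def compL {L R : ℕ} (π : Fin R → Fin L) (y : (Fin L ⊕ Fin L) → Bool) :
    (Fin R ⊕ Fin R) → Bool :=
  fun c => match c with
  | Sum.inl j => y (Sum.inl (π j))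
  | Sum.inr j => y (Sum.inr (π j))

/-- Probability weight of the `i`-th block of the noise pattern `(η, η')`:
`(η_i, η_{L+i}, η'_i, η'_{L+i})` is `(0,0,0,0)` with probability `1 − 2ε`, `(1,0,1,0)` with
probability `ε`, and `(0,1,0,1)` with probability `ε`. -/
noncomputable def patW {L : ℕ} (ε : ℝ) (η η' : (Fin L ⊕ Fin L) → Bool) (i : Fin L) : ℝ :=
  if η (Sum.inl i) = false ∧ η (Sum.inr i) = false ∧
     η' (Sum.inl i) = false ∧ η' (Sum.inr i) = false then 1 - 2 * ε
  else if η (Sum.inl i) = true ∧ η (Sum.inr i) = false ∧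
          η' (Sum.inl i) = true ∧ η' (Sum.inr i) = false then ε
  else if η (Sum.inl i) = false ∧ η (Sum.inr i) = true ∧
          η' (Sum.inl i) = false ∧ η' (Sum.inr i) = true then ε
  else 0

/-- Probability of the noise pattern `(η, η')` (blocks independent). -/
noncomputable def wprod {L : ℕ} (ε : ℝ) (η η' : (Fin L ⊕ Fin L) → Bool) : ℝ :=
  ∏ i : Fin L, patW ε η η' i

/-- The second queried point `x + y ∘ π + (η ∘ π)·z` of the test `𝒯₃`. -/
def arg2 {L R : ℕ} (π : Fin R → Fin L) (x z : (Fin R ⊕ Fin R) → Bool)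
    (y η : (Fin L ⊕ Fin L) → Bool) : (Fin R ⊕ Fin R) → Bool :=
  fun c => xor (x c) (xor (compL π y c) (compL π η c && z c))

/-- The fourth queried point `x' + y ∘ π + (η' ∘ π)·z' + 1̄` of the test `𝒯₃`. -/
def arg4 {L R : ℕ} (π : Fin R → Fin L) (x' z' : (Fin R ⊕ Fin R) → Bool)
    (y η' : (Fin L ⊕ Fin L) → Bool) : (Fin R ⊕ Fin R) → Bool :=
  fun c => xor (x' c) (xor (compL π y c) (xor (compL π η' c && z' c) true))

/-- The `4`-LIN constraint of the test `𝒯₃` evaluated on the assignment `fA`: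
`f_v(x) + f_v(x + y∘π_{uv} + (η∘π_{uv})·z) + f_w(x') + f_w(x' + y∘π_{uw} + (η'∘π_{uw})·z' + 1̄)
 = 1 (mod 2)`. -/
def accept3 {U V : Type} {L R : ℕ} (π : U → V → Fin R → Fin L)
    (fA : V → ((Fin R ⊕ Fin R) → Bool) → Bool) (u : U) (v w : V)
    (x x' z z' : (Fin R ⊕ Fin R) → Bool) (y η η' : (Fin L ⊕ Fin L) → Bool) : Prop :=
  xor (xor (fA v x) (fA v (arg2 (π u v) x z y η)))
      (xor (fA w x') (fA w (arg4 (π u w) x' z' y η'))) = true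

/-- The neighbors of `u ∈ U` in the bipartite graph. -/
def nbr {U V : Type} [Fintype V] (Adj : U → V → Bool) (u : U) : Finset V :=
  univ.filter (fun v => Adj u v = true)

/-- Expectation over the whole test distribution `𝒯₃`: a uniform `u ∈ U`, uniform
independent neighbors `v, w` of `u`, uniform `x, x', z, z' ∈ {0,1}^{2R}`, a uniform
`y ∈ {0,1}^{2L}` and the noise pattern `(η, η')`. -/
noncomputable def E3 {U V : Type} [Fintype U] [Fintype V] {L R : ℕ}
    (Adj : U → V → Bool) (ε : ℝ)
    (h : U → V → V → ((Fin R ⊕ Fin R) → Bool) → ((Fin R ⊕ Fin R) → Bool) →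
      ((Fin R ⊕ Fin R) → Bool) → ((Fin R ⊕ Fin R) → Bool) →
      ((Fin L ⊕ Fin L) → Bool) → ((Fin L ⊕ Fin L) → Bool) → ((Fin L ⊕ Fin L) → Bool) → ℝ) :
    ℝ :=
  (1 / (Fintype.card U : ℝ)) * ∑ u : U, (1 / ((nbr Adj u).card : ℝ) ^ 2) *
    ∑ v ∈ nbr Adj u, ∑ w ∈ nbr Adj u,
      ((1 : ℝ) / 2 ^ (2 * R)) ^ 4 * ((1 : ℝ) / 2 ^ (2 * L)) *
        ∑ x : (Fin R ⊕ Fin R) → Bool, ∑ x' : (Fin R ⊕ Fin R) → Bool,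
        ∑ z : (Fin R ⊕ Fin R) → Bool, ∑ z' : (Fin R ⊕ Fin R) → Bool,
        ∑ y : (Fin L ⊕ Fin L) → Bool,
        ∑ η : (Fin L ⊕ Fin L) → Bool, ∑ η' : (Fin L ⊕ Fin L) → Bool,
          wprod ε η η' * h u v w x x' z z' y η η'

/-- The sign `(-1)^b` of a bit `b`. -/
def bitSign (b : Bool) : ℝ := if b then -1 else 1

lemma bitSign_xor (a b : Bool) : bitSign (xor a b) = bitSign a * bitSign b := by
  cases a <;> cases b <;> simp [bitSign]

/-- The Walsh character indexed by `α`. -/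
def walsh {ι : Type*} (α : Finset ι) (x : ι → Bool) : ℝ := ∏ c ∈ α, bitSign (x c)

/-- The Walsh–Fourier coefficient of `f` at `α`. -/
noncomputable def walshCoeff {ι : Type*} [Fintype ι] [DecidableEq ι] (f : (ι → Bool) → ℝ)
    (α : Finset ι) : ℝ :=
  (∑ x, f x * walsh α x) / 2 ^ Fintype.card ι

section Walsh

variable {ι : Type*}

lemma walsh_xor (α : Finset ι) (x y : ι → Bool) :
    walsh α (fun c => xor (x c) (y c)) = walsh α x * walsh α y := by
  simp [walsh, bitSign_xor, prod_mul_distrib]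

lemma walsh_comp {κ : Type*} [Fintype κ] [DecidableEq κ] (ρ : ι → κ) (α : Finset ι)
    (y : κ → Bool) :
    walsh α (fun c => y (ρ c)) = ∏ l, bitSign (y l) ^ #{c ∈ α | ρ c = l} := by
  rw [walsh, ← prod_fiberwise α ρ]
  refine prod_congr rfl fun l _ => ?_
  rw [prod_congr rfl (g := fun _ => bitSign (y l))]
  · simp
  · intro c hc
    rw [(mem_filter.1 hc).2]

lemma sum_walsh_comp_mul {κ : Type*} [Fintype κ] [DecidableEq κ] (ρ σ : ι → κ)
    (α β : Finset ι) :
    ∑ y : κ → Bool, walsh α (fun c => y (ρ c)) * walsh β (fun c => y (σ c)) =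
      if ∀ l, Even (#{c ∈ α | ρ c = l} + #{c ∈ β | σ c = l}) then 2 ^ Fintype.card κ
      else 0 := by
  simp only [walsh_comp, ← prod_mul_distrib, ← pow_add]
  have h2 := (prod_univ_sum (fun _ : κ => (univ : Finset Bool))
    (fun l b => bitSign b ^ (#{c ∈ α | ρ c = l} + #{c ∈ β | σ c = l})))
  rw [Fintype.piFinset_univ] at h2
  rw [← h2]
  split_ifs with h
  · have : ∀ l, ∑ b, bitSign b ^ (#{c ∈ α | ρ c = l} + #{c ∈ β | σ c = l}) = 2 := by
      intro l
      simp only [Fintype.univ_bool, sum_pair (show true ≠ false by simp), bitSign]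
      simp only [if_true, (h l).neg_one_pow, Bool.false_eq_true, if_false, one_pow]
      norm_num
    rw [prod_congr rfl fun l _ => this l]
    simp
  · push Not at h
    obtain ⟨l, hl⟩ := h
    refine prod_eq_zero (mem_univ l) ?_
    simp only [Fintype.univ_bool, sum_pair (show true ≠ false by simp), bitSign]
    simp only [if_true, (Nat.not_even_iff_odd.1 hl).neg_one_pow, Bool.false_eq_true, if_false,
      one_pow]
    norm_num

variable [Fintype ι]

lemma sum_walsh (x : ι → Bool) :
    ∑ α : Finset ι, walsh α x = if x = (fun _ => false) then 2 ^ Fintype.card ι else 0 := by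
  have h : ∑ α : Finset ι, walsh α x = ∏ c, (1 + bitSign (x c)) := by
    rw [prod_one_add]; simp [walsh]
  rw [h]
  split_ifs with hx
  · subst hx
    simp [bitSign]
    norm_num
  · obtain ⟨c, hc⟩ : ∃ c, x c ≠ false := by
      by_contra! hcon
      exact hx (funext hcon)
    refine prod_eq_zero (mem_univ c) ?_
    simp only [ne_eq, Bool.not_eq_false] at hc
    simp [bitSign, hc]

variable [DecidableEq ι]

lemma sum_mul_shift (f : (ι → Bool) → ℝ) (a : ι → Bool) :
    ∑ x, f x * f (fun c => xor (x c) (a c)) =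
      2 ^ Fintype.card ι * ∑ α, walshCoeff f α ^ 2 * walsh α a := by
  have key : ∀ x x' : ι → Bool, ∑ α, walsh α x * walsh α x' * walsh α a =
      if x' = (fun c => xor (x c) (a c)) then 2 ^ Fintype.card ι else 0 := by
    intro x x'
    have h := sum_walsh (fun c => xor (xor (x c) (x' c)) (a c))
    simp only [walsh_xor (ι := ι) _ (fun c => xor (x c) (x' c)) a, walsh_xor] at h
    rw [h]
    congr 1
    simp only [funext_iff, eq_iff_iff]
    refine forall_congr' fun c => ?_
    cases x c <;> cases x' c <;> cases a c <;> simp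
  have h2 : ∑ α, walshCoeff f α ^ 2 * walsh α a =
      (∑ x, ∑ x', f x * f x' * ∑ α, walsh α x * walsh α x' * walsh α a) /
        (2 ^ Fintype.card ι) ^ 2 := by
    simp only [walshCoeff, div_pow, sq (∑ x, _), div_mul_eq_mul_div, ← sum_div,
      mul_sum, sum_mul]
    congr 1
    rw [sum_comm]
    refine sum_congr rfl fun x _ => ?_
    rw [sum_comm]
    refine sum_congr rfl fun x' _ => sum_congr rfl fun α _ => ?_
    ring
  rw [h2]
  simp only [key, mul_ite, mul_zero, sum_ite_eq', mem_univ, if_true, ← sum_mul]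
  field_simp

lemma sum_walshCoeff_sq (f : (ι → Bool) → ℝ) :
    ∑ α, walshCoeff f α ^ 2 = (∑ x, f x ^ 2) / 2 ^ Fintype.card ι := by
  have h := sum_mul_shift f (fun _ => false)
  simp only [Bool.xor_false, walsh, bitSign] at h
  rw [eq_div_iff (by positivity)]
  simp only [Bool.false_eq_true, if_false, prod_const_one, mul_one] at h
  simp only [sq] at h ⊢
  linarith

lemma sum_walsh_mask (α : Finset ι) (m : ι → Bool) :
    ∑ z : ι → Bool, walsh α (fun c => m c && z c) =
      if ∀ c ∈ α, m c = false then 2 ^ Fintype.card ι else 0 := by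
  have h : ∀ z : ι → Bool, walsh α (fun c => m c && z c) =
      ∏ c, if c ∈ α then bitSign (m c && z c) else 1 := by
    intro z; simp [walsh]
  simp only [h]
  have h2 := (prod_univ_sum (fun _ : ι => (univ : Finset Bool))
    (fun c b => if c ∈ α then bitSign (m c && b) else 1))
  rw [Fintype.piFinset_univ] at h2
  rw [← h2]
  split_ifs with hm
  · have : ∀ c, ∑ b, (if c ∈ α then bitSign (m c && b) else 1) = 2 := by
      intro c
      by_cases hc : c ∈ α
      · simp [hc, hm c hc, bitSign]
      · simp [hc]
    rw [prod_congr rfl fun c _ => this c]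
    simp
  · push Not at hm
    obtain ⟨c, hc, hmc⟩ := hm
    refine prod_eq_zero (mem_univ c) ?_
    simp only [ne_eq, Bool.not_eq_false] at hmc
    simp [hc, hmc, bitSign]

end Walsh

/-- The set of `j ∈ [R]` such that `j` or its copy `R + j` lies in `α`. -/
def blocks {R : ℕ} (α : Finset (Fin R ⊕ Fin R)) : Finset (Fin R) := α.image (Sum.elim id id)

/-- The noise pattern whose `i`-th block is `(1, 0)` if `b i` and `(0, 1)` otherwise. -/
def oneSided {L : ℕ} (b : Fin L → Bool) : (Fin L ⊕ Fin L) → Bool :=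
  Sum.elim b (fun i => !b i)

/-- The uniform distribution on `blocks α`. -/
noncomputable def pick {R : ℕ} (α : Finset (Fin R ⊕ Fin R)) (j : Fin R) : ℝ :=
  if j ∈ blocks α then 1 / (#(blocks α) : ℝ) else 0

/-- The push-forward of the weights `p` along `ρ`. -/
noncomputable def mass {L R : ℕ} (ρ : Fin R → Fin L) (p : Fin R → ℝ) (l : Fin L) : ℝ :=
  ∑ j, if ρ j = l then p j else 0

/-- `2^{-|ρ(blocks α)|}`, restricted to those `α` with `|blocks α| > T`. -/
noncomputable def tail {L R : ℕ} (T : ℝ) (ρ : Fin R → Fin L)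
    (α : Finset (Fin R ⊕ Fin R)) : ℝ :=
  if T < #(blocks α) then 1 / 2 ^ #((blocks α).image ρ) else 0

lemma wprod_oneSided_pos {L : ℕ} {ε : ℝ} (hε : 0 < ε) (b : Fin L → Bool) :
    0 < wprod ε (oneSided b) (oneSided b) := by
  refine prod_pos fun i _ => ?_
  cases h : b i <;> simp [patW, oneSided, h, hε]

lemma pick_nonneg {R : ℕ} (α : Finset (Fin R ⊕ Fin R)) (j : Fin R) : 0 ≤ pick α j := by
  unfold pick; positivity

lemma sum_pick_le_one {R : ℕ} (α : Finset (Fin R ⊕ Fin R)) : ∑ j, pick α j ≤ 1 := by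
  simp only [pick, sum_ite_mem, univ_inter, sum_const, nsmul_eq_mul, mul_one_div]
  exact div_self_le_one _

lemma tail_nonneg {L R : ℕ} (T : ℝ) (ρ : Fin R → Fin L) (α : Finset (Fin R ⊕ Fin R)) :
    0 ≤ tail T ρ α := by
  unfold tail; positivity

lemma mass_nonneg {L R : ℕ} (ρ : Fin R → Fin L) {p : Fin R → ℝ} (hp : ∀ j, 0 ≤ p j)
    (l : Fin L) : 0 ≤ mass ρ p l :=
  sum_nonneg fun j _ => by split_ifs <;> simp [hp]

lemma sum_mass {L R : ℕ} (ρ : Fin R → Fin L) (p : Fin R → ℝ) :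
    ∑ l, mass ρ p l = ∑ j, p j := by
  simp only [mass]
  rw [sum_comm]
  simp

lemma mass_sum {L R : ℕ} {A : Type*} [Fintype A] (ρ : Fin R → Fin L) (q : A → ℝ)
    (p : A → Fin R → ℝ) (l : Fin L) :
    mass ρ (fun j => ∑ a, q a * p a j) l = ∑ a, q a * mass ρ (p a) l := by
  simp only [mass, mul_sum]
  rw [sum_comm]
  refine sum_congr rfl fun j _ => ?_
  split_ifs <;> simp

/-- The number of one-sided patterns vanishing on the image of `α`. -/
lemma card_oneSided_vanish_le {L R : ℕ} (ρ : Fin R → Fin L) (α : Finset (Fin R ⊕ Fin R)) :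
    (#{b : Fin L → Bool | ∀ c ∈ α, compL ρ (oneSided b) c = false} : ℝ) ≤
      2 ^ L * (1 / 2 ^ #((blocks α).image ρ)) := by
  set A := (blocks α).image ρ with hA
  have hinj : #{b : Fin L → Bool | ∀ c ∈ α, compL ρ (oneSided b) c = false} ≤
      #(univ : Finset ({i // i ∉ A} → Bool)) := by
    refine card_le_card_of_injOn (fun b i => b i.1) (fun _ _ => mem_coe.2 (mem_univ _)) ?_
    intro b hb b' hb' hbb
    simp only [coe_filter, mem_univ, true_and, Set.mem_ofPred_eq] at hb hb'
    funext i
    by_cases hi : i ∈ A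
    · simp only [hA, blocks, mem_image] at hi
      obtain ⟨j, ⟨c, hc, rfl⟩, rfl⟩ := hi
      have h1 := hb c hc
      have h2 := hb' c hc
      cases c <;> simp_all [compL, oneSided]
    · exact congrFun hbb ⟨i, hi⟩
  have hcard : #(univ : Finset ({i // i ∉ A} → Bool)) = 2 ^ (L - #A) := by
    simp [Fintype.card_subtype_compl]
  rw [hcard] at hinj
  have hAL : #A ≤ L := by simpa using card_le_univ A
  calc (#{b : Fin L → Bool | ∀ c ∈ α, compL ρ (oneSided b) c = false} : ℝ)
      ≤ 2 ^ (L - #A) := by exact_mod_cast hinj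
    _ = 2 ^ L * (1 / 2 ^ #A) := by
      rw [pow_sub₀ _ (by norm_num) hAL]; simp

lemma one_le_sq_mul_agreement {L R : ℕ} {T : ℝ} (ρ σ : Fin R → Fin L)
    {α β : Finset (Fin R ⊕ Fin R)} (hα : (#(blocks α) : ℝ) ≤ T) (hβ : (#(blocks β) : ℝ) ≤ T)
    {j k : Fin R} (hj : j ∈ blocks α) (hk : k ∈ blocks β) (hjk : ρ j = σ k) :
    1 ≤ T ^ 2 * ∑ l, mass ρ (pick α) l * mass σ (pick β) l := by
  have hm : ∀ (τ : Fin R → Fin L) (γ : Finset (Fin R ⊕ Fin R)) (i : Fin R), i ∈ blocks γ →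
      (#(blocks γ) : ℝ) ≤ T → 1 ≤ T * mass τ (pick γ) (τ i) := by
    intro τ γ i hi hT
    have hpos : (0 : ℝ) < #(blocks γ) := by exact_mod_cast card_pos.2 ⟨i, hi⟩
    have h1 : 1 / (#(blocks γ) : ℝ) ≤ mass τ (pick γ) (τ i) := by
      refine le_trans (le_of_eq ?_) (single_le_sum (f := fun j => if τ j = τ i then pick γ j else 0)
        (fun j _ => ?_) (mem_univ i))
      · simp [pick, hi]
      · split_ifs <;> simp [pick_nonneg]
    calc 1 = #(blocks γ) * (1 / (#(blocks γ) : ℝ)) := by field_simp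
      _ ≤ T * mass τ (pick γ) (τ i) := by gcongr; exact hpos.le.trans hT
  have h1 := hm ρ α j hj hα
  have h2 := hm σ β k hk hβ
  have h3 : mass ρ (pick α) (ρ j) * mass σ (pick β) (ρ j) ≤
      ∑ l, mass ρ (pick α) l * mass σ (pick β) l :=
    single_le_sum (f := fun l => mass ρ (pick α) l * mass σ (pick β) l)
      (fun l _ => mul_nonneg (mass_nonneg _ (pick_nonneg _) _) (mass_nonneg _ (pick_nonneg _) _))
      (mem_univ _)
  rw [← hjk] at h2
  calc (1 : ℝ) ≤ (T * mass ρ (pick α) (ρ j)) * (T * mass σ (pick β) (ρ j)) :=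
        one_le_mul_of_one_le_of_one_le h1 h2
    _ = T ^ 2 * (mass ρ (pick α) (ρ j) * mass σ (pick β) (ρ j)) := by ring
    _ ≤ _ := by gcongr

/-- Replacing the shifts of the test by their Walsh characters and summing over the randomness
of the test, with one-sided noise. -/
lemma sum_walsh_shifts {L R : ℕ} (ρ σ : Fin R → Fin L) (α β : Finset (Fin R ⊕ Fin R)) :
    ∑ z : (Fin R ⊕ Fin R) → Bool, ∑ z' : (Fin R ⊕ Fin R) → Bool,
      ∑ y : (Fin L ⊕ Fin L) → Bool, ∑ b : Fin L → Bool,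
        walsh α (fun c => xor (compL ρ y c) (compL ρ (oneSided b) c && z c)) *
        walsh β (fun c => xor (compL σ y c) (xor (compL σ (oneSided b) c && z' c) true)) =
      (-1) ^ #β *
        (if ∀ l, Even (#{c ∈ α | Sum.map ρ ρ c = l} + #{c ∈ β | Sum.map σ σ c = l})
          then 2 ^ (2 * L) else 0) *
        ((2 ^ (2 * R)) ^ 2 * #{b : Fin L → Bool | (∀ c ∈ α, compL ρ (oneSided b) c = false) ∧
          ∀ c ∈ β, compL σ (oneSided b) c = false}) := by
  have hcomp : ∀ (τ : Fin R → Fin L) (y : (Fin L ⊕ Fin L) → Bool),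
      compL τ y = fun c => y (Sum.map τ τ c) := by
    intro τ y; funext c; cases c <;> rfl
  have hone : walsh β (fun _ => true) = (-1) ^ #β := by simp [walsh, bitSign]
  have hcardL : Fintype.card (Fin L ⊕ Fin L) = 2 * L := by simp; ring
  have hcardR : Fintype.card (Fin R ⊕ Fin R) = 2 * R := by simp; ring
  have hY := sum_walsh_comp_mul (Sum.map ρ ρ) (Sum.map σ σ) α β
  rw [hcardL] at hY
  rw [← hY]
  have hB : ((2 ^ (2 * R)) ^ 2 * (#{b : Fin L → Bool |
        (∀ c ∈ α, compL ρ (oneSided b) c = false) ∧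
          ∀ c ∈ β, compL σ (oneSided b) c = false} : ℝ) : ℝ) =
      ∑ b : Fin L → Bool, (∑ z : (Fin R ⊕ Fin R) → Bool, walsh α (fun c => compL ρ (oneSided b) c && z c)) *
        ∑ z' : (Fin R ⊕ Fin R) → Bool, walsh β (fun c => compL σ (oneSided b) c && z' c) := by
    simp only [sum_walsh_mask, hcardR]
    rw [card_filter, Nat.cast_sum, mul_sum]
    refine sum_congr rfl fun b _ => ?_
    by_cases h1 : ∀ c ∈ α, compL ρ (oneSided b) c = false <;>
    by_cases h2 : ∀ c ∈ β, compL σ (oneSided b) c = false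
    · rw [if_pos ⟨h1, h2⟩, if_pos h1, if_pos h2]; simp [sq]
    · rw [if_neg fun h => h2 h.2, if_neg h2]; simp
    · rw [if_neg fun h => h1 h.1, if_neg h1]; simp
    · rw [if_neg fun h => h1 h.1, if_neg h1]; simp
  rw [hB]
  have hterm : ∀ (z z' : (Fin R ⊕ Fin R) → Bool) (y : (Fin L ⊕ Fin L) → Bool)
      (b : Fin L → Bool),
      walsh α (fun c => xor (compL ρ y c) (compL ρ (oneSided b) c && z c)) *
        walsh β (fun c => xor (compL σ y c) (xor (compL σ (oneSided b) c && z' c) true)) =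
      ((-1) ^ #β * (walsh α (fun c => y (Sum.map ρ ρ c)) * walsh β (fun c => y (Sum.map σ σ c)))) *
        (walsh α (fun c => compL ρ (oneSided b) c && z c) *
          walsh β (fun c => compL σ (oneSided b) c && z' c)) := by
    intro z z' y b
    rw [walsh_xor, walsh_xor β (compL σ y), walsh_xor β _ (fun _ => true), hone, hcomp ρ y,
      hcomp σ y]
    ring
  simp only [hterm, ← mul_sum, ← sum_mul]
  have hswap : ∀ (F : (Fin L → Bool) → ((Fin R ⊕ Fin R) → Bool) → ℝ)
      (G : (Fin L → Bool) → ((Fin R ⊕ Fin R) → Bool) → ℝ),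
      ∑ z, ∑ z', ∑ b, F b z * G b z' = ∑ b, (∑ z, F b z) * ∑ z', G b z' := by
    intro F G
    simp only [sum_mul_sum]
    rw [sum_comm' (s := (univ : Finset (Fin L → Bool))) (t' := univ) (s' := fun _ => univ)
      (by simp)]
    refine sum_congr rfl fun z _ => ?_
    rw [sum_comm]
  rw [hswap]

/-- The kernel of the test at `(α, β)` is at least `[α = β = ∅]` up to the tail and agreement
terms. -/
lemma kernel_lower_bound {L R : ℕ} (T : ℝ) (ρ σ : Fin R → Fin L)
    (α β : Finset (Fin R ⊕ Fin R)) :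
    (2 ^ (2 * L) * ((2 ^ (2 * R)) ^ 2 * 2 ^ L) : ℝ) *
      ((if α = ∅ then 1 else 0) * (if β = ∅ then 1 else 0) -
        (tail T ρ α + tail T σ β + T ^ 2 * ∑ l, mass ρ (pick α) l * mass σ (pick β) l)) ≤
    ∑ z : (Fin R ⊕ Fin R) → Bool, ∑ z' : (Fin R ⊕ Fin R) → Bool,
      ∑ y : (Fin L ⊕ Fin L) → Bool, ∑ b : Fin L → Bool,
        walsh α (fun c => xor (compL ρ y c) (compL ρ (oneSided b) c && z c)) *
        walsh β (fun c => xor (compL σ y c) (xor (compL σ (oneSided b) c && z' c) true)) := by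
  have ht1 := tail_nonneg T ρ α
  have ht2 := tail_nonneg T σ β
  have ht3 : 0 ≤ T ^ 2 * ∑ l, mass ρ (pick α) l * mass σ (pick β) l :=
    mul_nonneg (sq_nonneg _) (sum_nonneg fun l _ =>
      mul_nonneg (mass_nonneg _ (pick_nonneg _) _) (mass_nonneg _ (pick_nonneg _) _))
  rw [sum_walsh_shifts]
  by_cases hempty : α = ∅ ∧ β = ∅
  · obtain ⟨rfl, rfl⟩ := hempty
    simp only [if_true, card_empty, pow_zero, one_mul, mul_one, filter_empty, add_zero,
      Even.zero, implies_true, notMem_empty, IsEmpty.forall_iff, and_self, filter_true, card_univ]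
    rw [Fintype.card_fun, Fintype.card_bool, Fintype.card_fin]
    push_cast
    refine mul_le_of_le_one_right (by positivity) (by linarith)
  have h0 : ((if α = ∅ then 1 else 0) * (if β = ∅ then 1 else 0) : ℝ) = 0 := by
    by_cases h1 : α = ∅ <;> by_cases h2 : β = ∅ <;> simp_all
  rw [h0, zero_sub]
  set N : ℝ := (#{b : Fin L → Bool | (∀ c ∈ α, compL ρ (oneSided b) c = false) ∧
          ∀ c ∈ β, compL σ (oneSided b) c = false} : ℝ) with hN
  have hN0 : 0 ≤ N := Nat.cast_nonneg _
  set C : ℝ := 2 ^ (2 * L) * ((2 ^ (2 * R)) ^ 2 * 2 ^ L) with hC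
  have hCpos : 0 ≤ C := by positivity
  split_ifs with hE
  swap
  · rw [mul_zero, zero_mul]
    exact mul_nonpos_of_nonneg_of_nonpos hCpos (by linarith)
  rcases Nat.even_or_odd #β with hβ | hβ
  · rw [hβ.neg_one_pow]
    exact (mul_nonpos_of_nonneg_of_nonpos hCpos (by linarith)).trans (by positivity)
  rw [hβ.neg_one_pow]
  have hNα : N ≤ 2 ^ L * (1 / 2 ^ #((blocks α).image ρ)) := by
    refine le_trans ?_ (card_oneSided_vanish_le ρ α)
    rw [hN]
    exact_mod_cast card_le_card fun b hb => by
      simp only [mem_filter, mem_univ, true_and] at hb ⊢; exact hb.1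
  have hNβ : N ≤ 2 ^ L * (1 / 2 ^ #((blocks β).image σ)) := by
    refine le_trans ?_ (card_oneSided_vanish_le σ β)
    rw [hN]
    exact_mod_cast card_le_card fun b hb => by
      simp only [mem_filter, mem_univ, true_and] at hb ⊢; exact hb.2
  have hNbound : N ≤ 2 ^ L *
      (tail T ρ α + tail T σ β + T ^ 2 * ∑ l, mass ρ (pick α) l * mass σ (pick β) l) := by
    by_cases hα' : T < #(blocks α)
    · refine hNα.trans ?_
      gcongr
      have : tail T ρ α = 1 / 2 ^ #((blocks α).image ρ) := by simp [tail, hα']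
      linarith
    by_cases hβ' : T < #(blocks β)
    · refine hNβ.trans ?_
      gcongr
      have : tail T σ β = 1 / 2 ^ #((blocks β).image σ) := by simp [tail, hβ']
      linarith
    have hodd : ∃ l, Odd #{c ∈ β | Sum.map σ σ c = l} := by
      by_contra! hcon
      simp only [Nat.not_odd_iff_even] at hcon
      refine Nat.not_even_iff_odd.2 hβ ?_
      rw [card_eq_sum_card_fiberwise (f := Sum.map σ σ) (t := univ) (by simp [Set.MapsTo])]
      exact even_sum _ fun l _ => hcon l
    obtain ⟨l, hl⟩ := hodd
    have hl' : Odd #{c ∈ α | Sum.map ρ ρ c = l} := by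
      have := hE l
      rw [Nat.even_add'] at this
      exact this.2 hl
    obtain ⟨c, hc⟩ := card_pos.1 hl'.pos
    obtain ⟨d, hd⟩ := card_pos.1 hl.pos
    rw [mem_filter] at hc hd
    have hcd := hc.2.trans hd.2.symm
    have hag := one_le_sq_mul_agreement (T := T) ρ σ (not_lt.1 hα') (not_lt.1 hβ')
      (j := Sum.elim id id c) (k := Sum.elim id id d) (mem_image_of_mem _ hc.1)
      (mem_image_of_mem _ hd.1) (by
        clear hN hNα hNβ hE h0 hempty
        cases c <;> cases d <;> simp at hcd <;> exact hcd)
    calc N ≤ 2 ^ L * (1 / 2 ^ #((blocks α).image ρ)) := hNα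
      _ ≤ 2 ^ L * 1 := by
        gcongr
        exact div_le_one_of_le₀ (one_le_pow₀ (by norm_num)) (by positivity)
      _ ≤ _ := by gcongr; linarith
  have := mul_le_mul_of_nonneg_left hNbound
    (show (0 : ℝ) ≤ 2 ^ (2 * L) * (2 ^ (2 * R)) ^ 2 by positivity)
  rw [hC]
  linarith

/-- The local estimate at a triple `(u, v, w)` of the test. -/
lemma local_estimate {L R : ℕ} (T : ℝ) (ρ σ : Fin R → Fin L)
    (q r : Finset (Fin R ⊕ Fin R) → ℝ) (hq : ∀ α, 0 ≤ q α) (hr : ∀ β, 0 ≤ r β)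
    (hq1 : ∑ α, q α ≤ 1) (hr1 : ∑ β, r β ≤ 1)
    (h : ∀ (z z' : (Fin R ⊕ Fin R) → Bool) (y : (Fin L ⊕ Fin L) → Bool) (b : Fin L → Bool),
      (∑ α, q α * walsh α (fun c => xor (compL ρ y c) (compL ρ (oneSided b) c && z c))) *
      (∑ β, r β * walsh β
        (fun c => xor (compL σ y c) (xor (compL σ (oneSided b) c && z' c) true))) = 0) :
    q ∅ * r ∅ ≤ ∑ α, q α * tail T ρ α + ∑ β, r β * tail T σ β +
      T ^ 2 * ∑ l, mass ρ (fun j => ∑ α, q α * pick α j) l *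
        mass σ (fun j => ∑ β, r β * pick β j) l := by
  set C : ℝ := 2 ^ (2 * L) * ((2 ^ (2 * R)) ^ 2 * 2 ^ L) with hC
  have hCpos : 0 < C := by positivity
  set K : Finset (Fin R ⊕ Fin R) → Finset (Fin R ⊕ Fin R) → ℝ := fun α β =>
    ∑ z : (Fin R ⊕ Fin R) → Bool, ∑ z' : (Fin R ⊕ Fin R) → Bool,
      ∑ y : (Fin L ⊕ Fin L) → Bool, ∑ b : Fin L → Bool,
        walsh α (fun c => xor (compL ρ y c) (compL ρ (oneSided b) c && z c)) *
        walsh β (fun c => xor (compL σ y c) (xor (compL σ (oneSided b) c && z' c) true)) with hK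
  have hzero : ∑ α, ∑ β, q α * r β * K α β = 0 := by
    have h1 : ∑ p : (((Fin R ⊕ Fin R) → Bool) × ((Fin R ⊕ Fin R) → Bool)) ×
        (((Fin L ⊕ Fin L) → Bool) × (Fin L → Bool)),
        (∑ α, q α * walsh α (fun c => xor (compL ρ p.2.1 c)
          (compL ρ (oneSided p.2.2) c && p.1.1 c))) *
        (∑ β, r β * walsh β (fun c => xor (compL σ p.2.1 c)
          (xor (compL σ (oneSided p.2.2) c && p.1.2 c) true))) = 0 :=
      sum_eq_zero fun p _ => h _ _ _ _
    rw [← h1]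
    simp only [sum_mul_sum]
    rw [sum_comm (s := (univ : Finset ((((Fin R ⊕ Fin R) → Bool) × ((Fin R ⊕ Fin R) → Bool)) ×
        (((Fin L ⊕ Fin L) → Bool) × (Fin L → Bool)))))]
    refine sum_congr rfl fun α _ => ?_
    rw [sum_comm (s := (univ : Finset ((((Fin R ⊕ Fin R) → Bool) × ((Fin R ⊕ Fin R) → Bool)) ×
        (((Fin L ⊕ Fin L) → Bool) × (Fin L → Bool)))))]
    refine sum_congr rfl fun β _ => ?_
    simp only [hK, Fintype.sum_prod_type, mul_sum]
    refine sum_congr rfl fun _ _ => sum_congr rfl fun _ _ => sum_congr rfl fun _ _ =>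
      sum_congr rfl fun _ _ => by ring
  have hlow : ∑ α, ∑ β, q α * r β * (C * ((if α = ∅ then 1 else 0) * (if β = ∅ then 1 else 0) -
      (tail T ρ α + tail T σ β + T ^ 2 * ∑ l, mass ρ (pick α) l * mass σ (pick β) l))) ≤ 0 := by
    refine le_of_le_of_eq ?_ hzero
    refine sum_le_sum fun α _ => sum_le_sum fun β _ => ?_
    exact mul_le_mul_of_nonneg_left (kernel_lower_bound T ρ σ α β) (mul_nonneg (hq α) (hr β))
  have hagree : ∑ l, mass ρ (fun j => ∑ α, q α * pick α j) l *
      mass σ (fun j => ∑ β, r β * pick β j) l =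
      ∑ α, ∑ β, q α * r β * ∑ l, mass ρ (pick α) l * mass σ (pick β) l := by
    simp only [mass_sum ρ q pick, mass_sum σ r pick, sum_mul_sum]
    simp only [mul_sum]
    rw [sum_comm]
    refine sum_congr rfl fun α _ => ?_
    rw [sum_comm]
    exact sum_congr rfl fun β _ => sum_congr rfl fun l _ => by ring
  have hempty : q ∅ * r ∅ = ∑ α, ∑ β, q α * r β *
      ((if α = ∅ then 1 else 0) * (if β = ∅ then 1 else 0)) := by
    simp
  have hexpand : ∀ M : Finset (Fin R ⊕ Fin R) → Finset (Fin R ⊕ Fin R) → ℝ,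
      ∑ α, ∑ β, q α * r β * (C * ((if α = ∅ then 1 else 0) *
        (if β = ∅ then 1 else 0) - (tail T ρ α + tail T σ β + T ^ 2 * M α β))) =
      C * (q ∅ * r ∅ - ((∑ α, q α * tail T ρ α) * ∑ β, r β +
        (∑ α, q α) * ∑ β, r β * tail T σ β + T ^ 2 * ∑ α, ∑ β, q α * r β * M α β)) := by
    intro M
    rw [hempty]
    simp only [sum_mul_sum]
    simp only [mul_sum, ← sum_add_distrib, ← sum_sub_distrib]
    exact sum_congr rfl fun α _ => sum_congr rfl fun β _ => by ring
  rw [hexpand, ← hagree] at hlow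
  have hfin := nonpos_of_mul_nonpos_right hlow hCpos
  have h1 : (∑ α, q α * tail T ρ α) * ∑ β, r β ≤ ∑ α, q α * tail T ρ α :=
    mul_le_of_le_one_right (sum_nonneg fun α _ => mul_nonneg (hq α) (tail_nonneg _ _ _)) hr1
  have h2 : (∑ α, q α) * ∑ β, r β * tail T σ β ≤ ∑ β, r β * tail T σ β :=
    mul_le_of_le_one_left (sum_nonneg fun β _ => mul_nonneg (hr β) (tail_nonneg _ _ _)) hq1
  linarith

/-- The estimate at a triple `(u, v, w)` for functions vanishing on the constraints. -/
lemma local_estimate_of_vanishing {L R : ℕ} (T : ℝ) (ρ σ : Fin R → Fin L)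
    (f g : ((Fin R ⊕ Fin R) → Bool) → ℝ) (hf : ∑ α, walshCoeff f α ^ 2 ≤ 1)
    (hg : ∑ α, walshCoeff g α ^ 2 ≤ 1)
    (h : ∀ (x x' z z' : (Fin R ⊕ Fin R) → Bool) (y : (Fin L ⊕ Fin L) → Bool)
      (b : Fin L → Bool),
      (f x * f (arg2 ρ x z y (oneSided b))) * (g x' * g (arg4 σ x' z' y (oneSided b))) = 0) :
    walshCoeff f ∅ ^ 2 * walshCoeff g ∅ ^ 2 ≤
      ∑ α, walshCoeff f α ^ 2 * tail T ρ α + ∑ β, walshCoeff g β ^ 2 * tail T σ β +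
      T ^ 2 * ∑ l, mass ρ (fun j => ∑ α, walshCoeff f α ^ 2 * pick α j) l *
        mass σ (fun j => ∑ β, walshCoeff g β ^ 2 * pick β j) l := by
  refine local_estimate T ρ σ _ _ (fun _ => sq_nonneg _) (fun _ => sq_nonneg _) hf hg ?_
  intro z z' y b
  have h1 := sum_mul_shift f (fun c => xor (compL ρ y c) (compL ρ (oneSided b) c && z c))
  have h2 := sum_mul_shift g
    (fun c => xor (compL σ y c) (xor (compL σ (oneSided b) c && z' c) true))
  have h3 : (∑ x, f x * f (arg2 ρ x z y (oneSided b))) *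
      (∑ x', g x' * g (arg4 σ x' z' y (oneSided b))) = 0 := by
    rw [sum_mul_sum]
    exact sum_eq_zero fun x _ => sum_eq_zero fun x' _ => h x x' z z' y b
  have h4 : ∀ x, arg2 ρ x z y (oneSided b) =
    fun c => xor (x c) (xor (compL ρ y c) (compL ρ (oneSided b) c && z c)) := fun _ => rfl
  have h5 : ∀ x', arg4 σ x' z' y (oneSided b) = fun c => xor (x' c)
    (xor (compL σ y c) (xor (compL σ (oneSided b) c && z' c) true)) := fun _ => rfl
  simp only [h4, h5] at h3
  rw [h1, h2] at h3
  have hpos : (2 : ℝ) ^ Fintype.card (Fin R ⊕ Fin R) ≠ 0 := by positivity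
  rcases mul_eq_zero.1 h3 with h6 | h6
  · rw [(mul_eq_zero.1 h6).resolve_left hpos, zero_mul]
  · rw [(mul_eq_zero.1 h6).resolve_left hpos, mul_zero]

section LabelCover

variable {U V : Type} [Fintype U] {L R : ℕ} {Adj : U → V → Bool} {π : U → V → Fin R → Fin L}
  {dU dV : ℕ}

/-- Smoothness bounds the average tail of a fixed frequency. -/
lemma sum_tail_le {c₀ T : ℝ} (hc₀ : 0 < c₀) (hT : 0 < T) (hdV : 0 < dV) (v : V)
    (hsmooth : ∀ α : Finset (Fin R), (1 / (dV : ℝ)) * ∑ u with Adj u v = true,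
      (1 : ℝ) / ((α.image (π u v)).card : ℝ) ≤ (α.card : ℝ) ^ (-(2 * c₀)))
    (α : Finset (Fin R ⊕ Fin R)) :
    ∑ u with Adj u v = true, tail T (π u v) α ≤ dV * T ^ (-(2 * c₀)) := by
  have hd : (0 : ℝ) < dV := by exact_mod_cast hdV
  by_cases h : T < #(blocks α)
  · have hcard : 0 < #(blocks α) := by exact_mod_cast hT.trans h
    calc ∑ u with Adj u v = true, tail T (π u v) α
        ≤ ∑ u with Adj u v = true, (1 : ℝ) / #((blocks α).image (π u v)) := by
          refine sum_le_sum fun u _ => ?_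
          rw [tail, if_pos h]
          have hk : 0 < #((blocks α).image (π u v)) := card_pos.2 ((card_pos.1 hcard).image _)
          refine one_div_le_one_div_of_le (by exact_mod_cast hk) ?_
          exact_mod_cast Nat.lt_two_pow_self.le
      _ = dV * ((1 / (dV : ℝ)) * ∑ u with Adj u v = true,
            (1 : ℝ) / #((blocks α).image (π u v))) := by field_simp
      _ ≤ dV * (#(blocks α) : ℝ) ^ (-(2 * c₀)) := by gcongr; exact hsmooth _
      _ ≤ dV * T ^ (-(2 * c₀)) := by
          gcongr 1
          exact Real.rpow_le_rpow_of_nonpos hT h.le (by linarith)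
  · rw [sum_eq_zero fun u _ => by rw [tail, if_neg h]]
    positivity

variable [Fintype V]

lemma sum_sum_nbr (Adj : U → V → Bool) (F : U → V → ℝ) :
    ∑ u, ∑ v ∈ nbr Adj u, F u v = ∑ v, ∑ u with Adj u v = true, F u v :=
  sum_comm' fun u v => by simp [nbr]

lemma card_edges (Adj : U → V → Bool) :
    #{p : U × V | Adj p.1 p.2 = true} = ∑ u, #(nbr Adj u) := by
  simp only [card_filter, nbr, Fintype.sum_prod_type]

/-- Random labels drawn from `p` agree on two random neighbours of a random `u` with probability
at most the soundness of the instance. -/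
lemma agreement_le {s : ℝ} (hU : ∀ u : U, #(nbr Adj u) = dU)
    (hs : ∀ (ℓU : U → Fin L) (ℓV : V → Fin R),
      (#{p : U × V | Adj p.1 p.2 = true ∧ π p.1 p.2 (ℓV p.2) = ℓU p.1} : ℝ)
        ≤ s * (#{p : U × V | Adj p.1 p.2 = true} : ℝ))
    (p : V → Fin R → ℝ) (hp : ∀ v j, 0 ≤ p v j) (hp1 : ∀ v, ∑ j, p v j ≤ 1) :
    ∑ u, ∑ l, (∑ v ∈ nbr Adj u, mass (π u v) (p v) l) ^ 2 ≤
      max s 0 * (Fintype.card U * (dU : ℝ) ^ 2) := by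
  rcases isEmpty_or_nonempty (Fin R) with hR | hR
  · have h0 : ∀ (u : U) (v : V) l, mass (π u v) (p v) l = 0 := fun u v l => by simp [mass]
    simp only [h0, sum_const_zero, ne_eq, OfNat.ofNat_ne_zero, not_false_eq_true, zero_pow]
    positivity
  rcases isEmpty_or_nonempty V with hV | hV
  · simp only [univ_eq_empty, nbr, filter_empty, sum_empty, sum_const_zero, ne_eq,
      OfNat.ofNat_ne_zero, not_false_eq_true, zero_pow]
    positivity
  rcases isEmpty_or_nonempty U with hU' | hU'
  · simp
  obtain ⟨v₀⟩ := hV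
  obtain ⟨u₀⟩ := hU'
  obtain ⟨j₀⟩ := hR
  have hL : Nonempty (Fin L) := ⟨π u₀ v₀ j₀⟩
  set P : U → Fin L → ℝ := fun u l => ∑ v ∈ nbr Adj u, mass (π u v) (p v) l with hP
  have hP0 : ∀ u l, 0 ≤ P u l := fun u l => sum_nonneg fun v _ => mass_nonneg _ (hp v) l
  have hPsum : ∀ u, ∑ l, P u l ≤ dU := by
    intro u
    rw [hP, sum_comm]
    simp only [sum_mass]
    calc ∑ v ∈ nbr Adj u, ∑ j, p v j ≤ ∑ v ∈ nbr Adj u, (1 : ℝ) := sum_le_sum fun v _ => hp1 v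
      _ = dU := by simp [hU]
  choose ℓU hℓU using fun u => Finite.exists_max (P u)
  set S : V → Fin R → ℝ := fun v j =>
    ∑ u with Adj u v = true, if π u v j = ℓU u then 1 else 0 with hS
  have hS0 : ∀ v j, 0 ≤ S v j := fun v j => sum_nonneg fun u _ => by positivity
  have hR : Nonempty (Fin R) := ⟨j₀⟩
  choose ℓV hℓV using fun v => Finite.exists_max (S v)
  have h1 : ∑ u, P u (ℓU u) = ∑ v, ∑ j, p v j * S v j := by
    rw [hP, sum_sum_nbr Adj (fun u v => mass (π u v) (p v) (ℓU u))]
    refine sum_congr rfl fun v _ => ?_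
    simp only [mass, hS, mul_sum, mul_ite, mul_one, mul_zero]
    rw [sum_comm]
  have h2 : ∑ v, S v (ℓV v) =
      (#{p : U × V | Adj p.1 p.2 = true ∧ π p.1 p.2 (ℓV p.2) = ℓU p.1} : ℝ) := by
    rw [hS, ← sum_sum_nbr Adj (fun u v => if π u v (ℓV v) = ℓU u then (1 : ℝ) else 0)]
    rw [card_filter, Nat.cast_sum, Fintype.sum_prod_type]
    refine sum_congr rfl fun u _ => ?_
    rw [nbr, sum_filter]
    refine sum_congr rfl fun v _ => ?_
    by_cases h : Adj u v = true <;> simp [h]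
  have h3 : ∑ u, P u (ℓU u) ≤ max s 0 * (Fintype.card U * dU) := by
    calc ∑ u, P u (ℓU u) = ∑ v, ∑ j, p v j * S v j := h1
      _ ≤ ∑ v, S v (ℓV v) := by
        refine sum_le_sum fun v _ => ?_
        calc ∑ j, p v j * S v j ≤ ∑ j, p v j * S v (ℓV v) :=
              sum_le_sum fun j _ => mul_le_mul_of_nonneg_left (hℓV v j) (hp v j)
          _ = (∑ j, p v j) * S v (ℓV v) := by rw [sum_mul]
          _ ≤ S v (ℓV v) := mul_le_of_le_one_left (hS0 _ _) (hp1 v)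
      _ ≤ s * (#{p : U × V | Adj p.1 p.2 = true} : ℝ) := h2 ▸ hs ℓU ℓV
      _ ≤ max s 0 * (#{p : U × V | Adj p.1 p.2 = true} : ℝ) := by
        gcongr; exact le_max_left _ _
      _ = max s 0 * (Fintype.card U * dU) := by
        rw [card_edges]; simp [hU]
  calc ∑ u, ∑ l, P u l ^ 2 ≤ ∑ u, P u (ℓU u) * dU := by
        refine sum_le_sum fun u _ => ?_
        calc ∑ l, P u l ^ 2 ≤ ∑ l, P u (ℓU u) * P u l := by
              refine sum_le_sum fun l _ => ?_
              rw [sq]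
              exact mul_le_mul_of_nonneg_right (hℓU u l) (hP0 u l)
          _ = P u (ℓU u) * ∑ l, P u l := by rw [mul_sum]
          _ ≤ P u (ℓU u) * dU := mul_le_mul_of_nonneg_left (hPsum u) (hP0 _ _)
    _ = (∑ u, P u (ℓU u)) * dU := by rw [sum_mul]
    _ ≤ max s 0 * (Fintype.card U * dU) * dU := by gcongr
    _ = _ := by ring

lemma card_mul_degree (hU : ∀ u : U, #(nbr Adj u) = dU)
    (hV : ∀ v : V, #{u : U | Adj u v = true} = dV) :
    (Fintype.card U : ℝ) * dU = Fintype.card V * dV := by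
  simpa [hU, hV] using sum_sum_nbr Adj (fun _ _ => (1 : ℝ))

/-- The Fourier-analytic soundness bound: a set of density `δ` avoiding all constraints with
one-sided noise forces `δ ^ 4` to be at most the smoothness error plus `T ^ 2` times the
soundness of the instance. -/
lemma density_pow_four_le [DecidableEq V] [Nonempty U] [Nonempty V] {c₀ T δ s : ℝ}
    (hc₀ : 0 < c₀) (hT : 0 < T) (hδ : 0 < δ) (hdU : 0 < dU) (hdV : 0 < dV)
    (hU : ∀ u : U, #(nbr Adj u) = dU)
    (hV : ∀ v : V, #{u : U | Adj u v = true} = dV)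
    (hsmooth : ∀ (v : V) (α : Finset (Fin R)), (1 / (dV : ℝ)) * ∑ u with Adj u v = true,
      (1 : ℝ) / ((α.image (π u v)).card : ℝ) ≤ (α.card : ℝ) ^ (-(2 * c₀)))
    (hs : ∀ (ℓU : U → Fin L) (ℓV : V → Fin R),
      (#{p : U × V | Adj p.1 p.2 = true ∧ π p.1 p.2 (ℓV p.2) = ℓU p.1} : ℝ)
        ≤ s * (#{p : U × V | Adj p.1 p.2 = true} : ℝ))
    (I : Finset (V × ((Fin R ⊕ Fin R) → Bool)))
    (hI : δ * ((Fintype.card V : ℝ) * 2 ^ (2 * R)) ≤ (I.card : ℝ))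
    (hind : ∀ (u : U) (v w : V) (x x' z z' : (Fin R ⊕ Fin R) → Bool)
      (y : (Fin L ⊕ Fin L) → Bool) (b : Fin L → Bool), Adj u v = true → Adj u w = true →
      ¬ ((v, x) ∈ I ∧ (v, arg2 (π u v) x z y (oneSided b)) ∈ I ∧
        (w, x') ∈ I ∧ (w, arg4 (π u w) x' z' y (oneSided b)) ∈ I)) :
    δ ^ 4 ≤ 2 * T ^ (-(2 * c₀)) + T ^ 2 * max s 0 := by
  set f : V → ((Fin R ⊕ Fin R) → Bool) → ℝ := fun v x => if (v, x) ∈ I then 1 else 0 with hf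
  set q : V → Finset (Fin R ⊕ Fin R) → ℝ := fun v α => walshCoeff (f v) α ^ 2 with hq
  set p : V → Fin R → ℝ := fun v j => ∑ α, q v α * pick α j with hp
  have hq0 : ∀ v α, 0 ≤ q v α := fun v α => sq_nonneg _
  have hcardR : Fintype.card (Fin R ⊕ Fin R) = 2 * R := by simp; ring
  have hq1 : ∀ v, ∑ α, q v α ≤ 1 := by
    intro v
    simp only [hq]
    rw [sum_walshCoeff_sq, div_le_one (by positivity)]
    calc ∑ x, f v x ^ 2 ≤ ∑ x : (Fin R ⊕ Fin R) → Bool, (1 : ℝ) :=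
          sum_le_sum fun x _ => by simp only [hf]; split_ifs <;> norm_num
      _ = 2 ^ Fintype.card (Fin R ⊕ Fin R) := by simp
  have hp0 : ∀ v j, 0 ≤ p v j :=
    fun v j => sum_nonneg fun α _ => mul_nonneg (hq0 v α) (pick_nonneg α j)
  have hp1 : ∀ v, ∑ j, p v j ≤ 1 := by
    intro v
    simp only [hp]
    rw [sum_comm]
    simp only [← mul_sum]
    exact (sum_le_sum fun α _ => mul_le_of_le_one_right (hq0 v α) (sum_pick_le_one α)).trans
      (hq1 v)
  set A : U → V → ℝ := fun u v => ∑ α, q v α * tail T (π u v) α with hA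
  have hlocal : ∀ u, ∀ v ∈ nbr Adj u, ∀ w ∈ nbr Adj u, q v ∅ * q w ∅ ≤ A u v + A u w +
      T ^ 2 * ∑ l, mass (π u v) (p v) l * mass (π u w) (p w) l := by
    intro u v hv w hw
    refine local_estimate_of_vanishing T (π u v) (π u w) (f v) (f w) (hq1 v) (hq1 w) ?_
    intro x x' z z' y b
    have := hind u v w x x' z z' y b (by simpa [nbr] using hv) (by simpa [nbr] using hw)
    simp only [hf, mul_ite, mul_one, mul_zero]
    split_ifs <;> simp_all
  have hupper : ∑ u, (∑ v ∈ nbr Adj u, q v ∅) ^ 2 ≤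
      2 * dU * ∑ u, ∑ v ∈ nbr Adj u, A u v +
        T ^ 2 * ∑ u, ∑ l, (∑ v ∈ nbr Adj u, mass (π u v) (p v) l) ^ 2 := by
    rw [mul_sum, mul_sum, ← sum_add_distrib]
    refine sum_le_sum fun u _ => ?_
    calc (∑ v ∈ nbr Adj u, q v ∅) ^ 2 = ∑ v ∈ nbr Adj u, ∑ w ∈ nbr Adj u, q v ∅ * q w ∅ := by
          rw [sq, sum_mul_sum]
      _ ≤ ∑ v ∈ nbr Adj u, ∑ w ∈ nbr Adj u, (A u v + A u w +
          T ^ 2 * ∑ l, mass (π u v) (p v) l * mass (π u w) (p w) l) :=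
        sum_le_sum fun v hv => sum_le_sum fun w hw => hlocal u v hv w hw
      _ = _ := by
        simp only [sum_add_distrib, sum_const, hU, nsmul_eq_mul, ← mul_sum]
        have : ∑ l, (∑ v ∈ nbr Adj u, mass (π u v) (p v) l) ^ 2 =
            ∑ v ∈ nbr Adj u, ∑ w ∈ nbr Adj u,
              ∑ l, mass (π u v) (p v) l * mass (π u w) (p w) l := by
          simp only [sq, sum_mul_sum]
          rw [sum_comm]
          exact sum_congr rfl fun v _ => sum_comm
        rw [this]
        ring
  have htail : ∑ u, ∑ v ∈ nbr Adj u, A u v ≤ Fintype.card U * dU * T ^ (-(2 * c₀)) := by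
    rw [sum_sum_nbr Adj A, card_mul_degree hU hV]
    calc ∑ v, ∑ u with Adj u v = true, A u v
        ≤ ∑ v : V, dV * T ^ (-(2 * c₀)) := by
          refine sum_le_sum fun v _ => ?_
          simp only [hA]
          rw [sum_comm]
          simp only [← mul_sum]
          calc ∑ α, q v α * ∑ u with Adj u v = true, tail T (π u v) α
              ≤ ∑ α, q v α * (dV * T ^ (-(2 * c₀))) := sum_le_sum fun α _ =>
                mul_le_mul_of_nonneg_left (sum_tail_le hc₀ hT hdV v (hsmooth v) α) (hq0 v α)
            _ = (∑ α, q v α) * (dV * T ^ (-(2 * c₀))) := by rw [sum_mul]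
            _ ≤ _ := mul_le_of_le_one_left (by positivity) (hq1 v)
      _ = _ := by simp; ring
  have hagree := agreement_le hU hs p hp0 hp1
  have hmean : ∑ v, walshCoeff (f v) ∅ = #I / 2 ^ (2 * R) := by
    simp only [walshCoeff, walsh, prod_empty, mul_one, hcardR, ← sum_div]
    congr 1
    rw [← Fintype.sum_prod_type']
    simp [hf]
  have hnV : (0 : ℝ) < Fintype.card V := by exact_mod_cast Fintype.card_pos
  have hnU : (0 : ℝ) < Fintype.card U := by exact_mod_cast Fintype.card_pos
  have hdU' : (0 : ℝ) < dU := by exact_mod_cast hdU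
  have hdeg := card_mul_degree hU hV
  have hmean' : δ * Fintype.card V ≤ ∑ v, walshCoeff (f v) ∅ := by
    rw [hmean, le_div_iff₀ (by positivity)]
    linarith
  have hQ : δ ^ 2 * Fintype.card V ≤ ∑ v, q v ∅ := by
    have hcs := sq_sum_le_card_mul_sum_sq (s := (univ : Finset V))
      (f := fun v => walshCoeff (f v) ∅)
    have h2 := pow_le_pow_left₀ (by positivity) hmean' 2
    rw [card_univ] at hcs
    refine le_of_mul_le_mul_left ?_ hnV
    calc (Fintype.card V : ℝ) * (δ ^ 2 * Fintype.card V) = (δ * Fintype.card V) ^ 2 := by ring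
      _ ≤ _ := h2.trans hcs
  have hlower : (Fintype.card U * (dU : ℝ) ^ 2) * δ ^ 4 ≤ ∑ u, (∑ v ∈ nbr Adj u, q v ∅) ^ 2 := by
    have hcs := sq_sum_le_card_mul_sum_sq (s := (univ : Finset U))
      (f := fun u => ∑ v ∈ nbr Adj u, q v ∅)
    have h1 : ∑ u, ∑ v ∈ nbr Adj u, q v ∅ = dV * ∑ v, q v ∅ := by
      rw [sum_sum_nbr Adj (fun _ v => q v ∅), mul_sum]
      simp [hV]
    rw [h1, card_univ] at hcs
    refine le_of_mul_le_mul_left ?_ hnU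
    calc (Fintype.card U : ℝ) * ((Fintype.card U * (dU : ℝ) ^ 2) * δ ^ 4)
        = (Fintype.card U * (dU : ℝ)) ^ 2 * δ ^ 4 := by ring
      _ = (dV * (δ ^ 2 * Fintype.card V)) ^ 2 := by rw [hdeg]; ring
      _ ≤ (dV * ∑ v, q v ∅) ^ 2 := by gcongr
      _ ≤ _ := hcs
  refine le_of_mul_le_mul_left ?_ (show (0 : ℝ) < Fintype.card U * (dU : ℝ) ^ 2 by positivity)
  calc (Fintype.card U * (dU : ℝ) ^ 2) * δ ^ 4
      ≤ 2 * dU * ∑ u, ∑ v ∈ nbr Adj u, A u v +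
        T ^ 2 * ∑ u, ∑ l, (∑ v ∈ nbr Adj u, mass (π u v) (p v) l) ^ 2 := hlower.trans hupper
    _ ≤ 2 * dU * (Fintype.card U * dU * T ^ (-(2 * c₀))) +
        T ^ 2 * (max s 0 * (Fintype.card U * (dU : ℝ) ^ 2)) := by gcongr
    _ = _ := by ring

end LabelCover

/-- soundness of `𝒯₃`: for constants `c₀ ∈ (0, 1/3)` and `ε ∈ (0, 1/2)`
there is `δ₀ > 0` such that for every `δ ∈ (0, δ₀)`: if a bi-regular, `c₀`-smooth
Label-Cover instance is such that every labeling satisfies at most an `s` fraction of its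
edges, where `s < δ^{10/c₀ + 5}/4`, then the constraint hypergraph of the `4`-LIN-CSP
instance `𝒢` produced by `𝒯₃` has no independent set of fractional size `δ`: there is no
`I ⊆ V × {0,1}^{2R}` with `|I| ≥ δ·|V|·2^{2R}` such that no constraint `4`-tuple occurring
with positive probability under `𝒯₃` has all four queried variables inside `I`. -/
theorem stmt_18 (c₀ : ℝ) (hc₀1 : 0 < c₀) (hc₀2 : c₀ < 1 / 3)
    (ε : ℝ) (hε1 : 0 < ε) (hε2 : ε < 1 / 2) :
    ∃ δ₀ : ℝ, 0 < δ₀ ∧ ∀ δ : ℝ, 0 < δ → δ < δ₀ →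
      ∀ (L R : ℕ) (U V : Type) [Fintype U] [Fintype V] [DecidableEq V] [Nonempty U]
        [Nonempty V]
        (Adj : U → V → Bool) (π : U → V → Fin R → Fin L)
        (dU dV : ℕ), 0 < dU → 0 < dV →
        (∀ u : U, (nbr Adj u).card = dU) →
        (∀ v : V, (univ.filter (fun u : U => Adj u v = true)).card = dV) →
        (∀ (v : V) (α : Finset (Fin R)),
          (1 / (dV : ℝ)) * ∑ u ∈ univ.filter (fun u : U => Adj u v = true),
              (1 : ℝ) / ((α.image (π u v)).card : ℝ)
            ≤ (α.card : ℝ) ^ (-(2 * c₀))) →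
      ∀ s : ℝ, s < δ ^ (10 / c₀ + 5) / 4 →
        (∀ (ℓU : U → Fin L) (ℓV : V → Fin R),
          ((univ.filter (fun p : U × V =>
              Adj p.1 p.2 = true ∧ π p.1 p.2 (ℓV p.2) = ℓU p.1)).card : ℝ)
            ≤ s * ((univ.filter (fun p : U × V => Adj p.1 p.2 = true)).card : ℝ)) →
      ¬ ∃ I : Finset (V × ((Fin R ⊕ Fin R) → Bool)),
          δ * ((Fintype.card V : ℝ) * 2 ^ (2 * R)) ≤ (I.card : ℝ) ∧
          ∀ (u : U) (v w : V) (x x' z z' : (Fin R ⊕ Fin R) → Bool)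
            (y η η' : (Fin L ⊕ Fin L) → Bool),
            Adj u v = true → Adj u w = true → 0 < wprod ε η η' →
            ¬ ((v, x) ∈ I ∧ (v, arg2 (π u v) x z y η) ∈ I ∧
               (w, x') ∈ I ∧ (w, arg4 (π u w) x' z' y η') ∈ I) := by
  refine ⟨1 / 2, by norm_num, ?_⟩
  intro δ hδ hδ' L R U V _ _ _ _ _ Adj π dU dV hdU hdV hU hV hsmooth s hs hsound
  rintro ⟨I, hI, hind⟩
  set T : ℝ := δ ^ (-(5 / c₀)) with hT
  have hTpos : 0 < T := Real.rpow_pos_of_pos hδ _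
  have hmain := density_pow_four_le hc₀1 hTpos hδ hdU hdV hU hV hsmooth hsound I hI
    fun u v w x x' z z' y b hv hw =>
      hind u v w x x' z z' y _ _ hv hw (wprod_oneSided_pos hε1 b)
  have hT1 : T ^ (-(2 * c₀)) = δ ^ 10 := by
    rw [hT, ← Real.rpow_mul hδ.le, ← Real.rpow_natCast]
    congr 1
    field_simp
    norm_num
  have hT2 : T ^ 2 * (δ ^ (10 / c₀ + 5) / 4) = δ ^ 5 / 4 := by
    rw [hT, ← Real.rpow_natCast, ← Real.rpow_mul hδ.le, ← mul_div_assoc, ← Real.rpow_add hδ,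
      ← Real.rpow_natCast δ 5]
    congr 2
    push_cast
    ring
  have hs' : max s 0 ≤ δ ^ (10 / c₀ + 5) / 4 := max_le hs.le (by positivity)
  have hbound : δ ^ 4 ≤ 2 * δ ^ 10 + δ ^ 5 / 4 := by
    rw [← hT1, ← hT2]
    exact hmain.trans (by gcongr)
  have h6 : δ ^ 6 ≤ (1 / 2) ^ 6 := by gcongr
  have h4 : 0 < δ ^ 4 := by positivity
  have h7 : δ ^ 10 ≤ (1 / 2) ^ 6 * δ ^ 4 := by
    calc δ ^ 10 = δ ^ 6 * δ ^ 4 := by ring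
      _ ≤ _ := by gcongr
  have h8 : δ ^ 5 ≤ 1 / 2 * δ ^ 4 := by
    calc δ ^ 5 = δ * δ ^ 4 := by ring
      _ ≤ _ := by gcongr
  norm_num at h7
  linarith
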